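/- There exist a nonzero real τ and a real c such that for every nonnegative integer n and every real x, the limit of p_n(x; 1/s, 1/t, 1/u, 1/v) as (s,t,u,v)→(0,0,0,0) within the open orthant (0,∞)⁴ exists and equals τ^n·h_n((x−c)/τ); that is, in the joint limit α,b,d,ν→∞ the rescaled monic Racah polynomials become rescaled monic Hermite polynomials. -/

import Mathlib

open Filter Real

/-- Pochhammer symbol `(a)_m = a (a+1) ⋯ (a+m-1)`. -/
noncomputable def poch (a : ℝ) (m : ℕ) : ℝ := ∏ j ∈ Finset.range m, (a + j)

/-- Monic Hermite polynomial of degree `n`. -/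
noncomputable def monicHermite (n : ℕ) (x : ℝ) : ℝ :=
  (n.factorial : ℝ) * ∑ m ∈ Finset.range (n / 2 + 1),
    (-1 : ℝ) ^ m * x ^ (n - 2 * m) / (4 ^ m * m.factorial * (n - 2 * m).factorial)

/-- Monic Laguerre polynomial of degree `n` with parameter `α`. -/
noncomputable def monicLaguerre (α : ℝ) (n : ℕ) (x : ℝ) : ℝ :=
  (-1 : ℝ) ^ n * n.factorial * ∑ k ∈ Finset.range (n + 1),
    (-1 : ℝ) ^ k * (poch (α + k + 1) (n - k) / ((n - k).factorial * k.factorial)) * x ^ k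

/-- Monic Jacobi polynomial of degree `n` with parameters `α, β`. -/
noncomputable def monicJacobi (α β : ℝ) (n : ℕ) (x : ℝ) : ℝ :=
  ((n.factorial : ℝ) / poch (n + α + β + 1) n) *
    ∑ k ∈ Finset.range (n + 1),
      (poch (n + α - k + 1) k / k.factorial) *
      (poch (β + k + 1) (n - k) / (n - k).factorial) *
      (x - 1) ^ (n - k) * (x + 1) ^ k

/-- Monic Racah polynomial of degree `n` in the variable `y`. -/
noncomputable def monicRacah (α β N δ : ℝ) (n : ℕ) (y : ℝ) : ℝ :=
  (1 / poch (n + α + β + 1) n) *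
    ∑ k ∈ Finset.range (n + 1),
      (poch (-(n : ℝ)) k * poch (n + α + β + 1) k / k.factorial) *
      poch (α + k + 1) (n - k) * poch (β + δ + k + 1) (n - k) * poch (k - N) (n - k) *
      ∏ j ∈ Finset.range k, ((j : ℝ) * (j + δ - N) - y)

/-- Monic Hahn polynomial of degree `n`. -/
noncomputable def monicHahn (α β N : ℝ) (n : ℕ) (x : ℝ) : ℝ :=
  (1 / poch (n + α + β + 1) n) *
    ∑ k ∈ Finset.range (n + 1),
      (poch (-(n : ℝ)) k * poch (n + α + β + 1) k * poch (-x) k / k.factorial) *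
      poch (α + k + 1) (n - k) * poch (k - N) (n - k)

/-- Monic Meixner polynomial of degree `n`. -/
noncomputable def monicMeixner (b c : ℝ) (n : ℕ) (x : ℝ) : ℝ :=
  (c / (c - 1)) ^ n * ∑ k ∈ Finset.range (n + 1),
    (poch (-(n : ℝ)) k * poch (-x) k / k.factorial) * poch (b + k) (n - k) * (1 - 1 / c) ^ k

/-- Monic Krawtchouk polynomial of degree `n`. -/
noncomputable def monicKrawtchouk (p N : ℝ) (n : ℕ) (x : ℝ) : ℝ :=
  p ^ n * ∑ k ∈ Finset.range (n + 1),
    (poch (-(n : ℝ)) k * poch (-x) k / k.factorial) * poch (k - N) (n - k) * (1 / p) ^ k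

/-- `ρ = (α+β)^{3/2} / (αβ)^{1/2}`. -/
noncomputable def jacobiRho (α β : ℝ) : ℝ := (α + β) ^ ((3 : ℝ) / 2) / Real.sqrt (α * β)

/-- `σ = (α-β)/(α+β)`. -/
noncomputable def jacobiSigma (α β : ℝ) : ℝ := (α - β) / (α + β)

/-- Uniformly rescaled monic Jacobi polynomial `p_n(x; α, β) = ρ^n p_n^{(α,β)}(ρ⁻¹x - σ)`. -/
noncomputable def rescaledJacobi (α β : ℝ) (n : ℕ) (x : ℝ) : ℝ :=
  jacobiRho α β ^ n * monicJacobi α β n (x / jacobiRho α β - jacobiSigma α β)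

/-- `ρ = ((α+β)³/(αβ(β+δ)(N+α+β)(δ-α)N))^{1/2}` with `β = bα`, `δ = (bdν+1)α`, `N = bν`. -/
noncomputable def racahRho (α b d ν : ℝ) : ℝ :=
  Real.sqrt ((α + b * α) ^ 3 /
    (α * (b * α) * (b * α + (b * d * ν + 1) * α) * (b * ν + α + b * α) *
      ((b * d * ν + 1) * α - α) * (b * ν)))

/-- `σ = -N(α+1)(β+δ+1)/(α+β+2)` with `β = bα`, `δ = (bdν+1)α`, `N = bν`. -/
noncomputable def racahSigma (α b d ν : ℝ) : ℝ :=
  -((b * ν) * (α + 1) * (b * α + (b * d * ν + 1) * α + 1)) / (α + b * α + 2)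

/-- Rescaled monic Racah polynomial `p_n(x; α, b, d, ν) = ρ^n r_n(ρ⁻¹x - σ; α, bα, bν, (bdν+1)α)`. -/
noncomputable def rescaledRacah (α b d ν : ℝ) (n : ℕ) (x : ℝ) : ℝ :=
  racahRho α b d ν ^ n *
    monicRacah α (b * α) (b * ν) ((b * d * ν + 1) * α) n
      (x / racahRho α b d ν - racahSigma α b d ν)

theorem poch_succ (a : ℝ) (m : ℕ) : poch a (m + 1) = poch a m * (a + m) := by
  simp [poch, Finset.prod_range_succ]

theorem poch_succ' (a : ℝ) (m : ℕ) : poch a (m + 1) = a * poch (a + 1) m := by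
  simp only [poch, Finset.prod_range_succ']
  rw [mul_comm]
  congr 1
  · simp
  · refine Finset.prod_congr rfl fun j _ => ?_
    push_cast
    ring

theorem poch_pos {a : ℝ} (ha : 0 < a) (m : ℕ) : 0 < poch a m :=
  Finset.prod_pos fun _ _ => by positivity

theorem poch_add (a : ℝ) (k m : ℕ) : poch a (k + m) = poch a k * poch (a + k) m := by
  induction m with
  | zero => simp [poch]
  | succ m ih => rw [← add_assoc, poch_succ, ih, poch_succ]; push_cast; ring

theorem poch_neg_natCast_div_factorial (n k : ℕ) :
    poch (-(n : ℝ)) k / k.factorial = (-1) ^ k * n.choose k := by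
  induction k with
  | zero => simp [poch]
  | succ k ih =>
    have hk : (k.factorial : ℝ) ≠ 0 := by positivity
    have hk1 : (k : ℝ) + 1 ≠ 0 := by positivity
    have hc : (n.choose (k + 1) : ℝ) * (k + 1) = n.choose k * ((n : ℝ) - k) := by
      rcases le_or_gt k n with h | h
      · have := Nat.choose_succ_right_eq n k
        rw [← Nat.cast_sub h]
        exact_mod_cast this
      · simp [Nat.choose_eq_zero_of_lt h, Nat.choose_eq_zero_of_lt (h.trans (Nat.lt_succ_self k))]
    rw [div_eq_iff hk] at ih
    rw [poch_succ, ih, Nat.factorial_succ, div_eq_iff (by positivity)]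
    push_cast
    linear_combination (-(-1 : ℝ) ^ (k + 1) * k.factorial) * hc

/-- The coefficients of the monic Racah polynomial of degree `n` in the basis
`∏ j < k, (j (j + δ - N) - y)`. -/
noncomputable def racahCoeff (α β N δ : ℝ) (n k : ℕ) : ℝ :=
  (-1) ^ k * n.choose k * (poch (α + k + 1) (n - k) * poch (β + δ + k + 1) (n - k) *
    poch (k - N) (n - k)) / poch (n + k + α + β + 1) (n - k)

/-- The basis `∏ j < k, (j (j + δ - N) - y)`. -/
noncomputable def racahBasis (N δ : ℝ) (k : ℕ) (y : ℝ) : ℝ :=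
  ∏ j ∈ Finset.range k, ((j : ℝ) * (j + δ - N) - y)

/-- The recurrence coefficient `A_n` of the Racah polynomials. -/
noncomputable def racahA (α β N δ : ℝ) (n : ℕ) : ℝ :=
  (n + α + 1) * (n + α + β + 1) * (n + β + δ + 1) * (n - N) /
    ((2 * n + α + β + 1) * (2 * n + α + β + 2))

/-- The recurrence coefficient `C_n` of the Racah polynomials. -/
noncomputable def racahC (α β N δ : ℝ) (n : ℕ) : ℝ :=
  n * (n + α + β + N + 1) * (n + α - δ) * (n + β) /
    ((2 * n + α + β) * (2 * n + α + β + 1))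

theorem monicRacah_eq_sum {α β : ℝ} (h : 0 < α + β) (N δ : ℝ) (n : ℕ) (y : ℝ) :
    monicRacah α β N δ n y =
      ∑ k ∈ Finset.range (n + 1), racahCoeff α β N δ n k * racahBasis N δ k y := by
  rw [monicRacah, Finset.mul_sum]
  refine Finset.sum_congr rfl fun k hk => ?_
  have hkn : k + (n - k) = n := by
    have := Finset.mem_range.1 hk
    omega
  have hp : ∀ i m : ℕ, poch (n + i + α + β + 1) m ≠ 0 := fun i m =>
    (poch_pos (by have : (0 : ℝ) ≤ n + i := by positivity
                  linarith) m).ne'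
  have h0 := hp 0
  simp only [Nat.cast_zero, add_zero] at h0
  have hs : poch (n + α + β + 1) n = poch (n + α + β + 1) k * poch (n + k + α + β + 1) (n - k) := by
    conv_lhs => rw [← hkn, poch_add]
    rw [hkn]
    congr 2
    ring
  rw [mul_div_right_comm (poch (-(n : ℝ)) k), poch_neg_natCast_div_factorial, hs, racahCoeff,
    racahBasis]
  have h1 := h0 k
  have h2 := hp k (n - k)
  field_simp

theorem racahCoeff_eq_zero (α β N δ : ℝ) {n k : ℕ} (h : n < k) :
    racahCoeff α β N δ n k = 0 := by
  simp [racahCoeff, Nat.choose_eq_zero_of_lt h]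

theorem racahCoeff_self (α β N δ : ℝ) (n : ℕ) : racahCoeff α β N δ n n = (-1) ^ n := by
  simp [racahCoeff, poch]

theorem racahCoeff_succ_left {α β : ℝ} (h : 0 < α + β) (N δ : ℝ) {n k : ℕ} (hk : k ≤ n) :
    racahCoeff α β N δ (n + 1) k = racahCoeff α β N δ n k *
      (((n + 1) / (n + 1 - k)) * ((n + α + 1) * (n + β + δ + 1) * (n - N)) *
        ((n + k + α + β + 1) / ((2 * n + α + β + 1) * (2 * n + α + β + 2)))) := by
  obtain ⟨m, rfl⟩ := Nat.exists_eq_add_of_le hk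
  have hc : ((k + m + 1).choose k : ℝ) * (m + 1) = (k + m).choose k * (k + m + 1) := by
    have := Nat.choose_mul_succ_eq (k + m) k
    rw [show k + m + 1 - k = m + 1 by omega] at this
    exact_mod_cast this.symm
  have e1 : k + m + 1 - k = m + 1 := by omega
  have e2 : k + m - k = m := by omega
  have hm : (m : ℝ) + 1 ≠ 0 := by positivity
  have hkR : (0 : ℝ) ≤ k := by positivity
  have hmR : (0 : ℝ) ≤ m := by positivity
  set a : ℝ := (k + m : ℕ) + k + α + β + 1 with ha
  have ha0 : 0 < a := by rw [ha]; push_cast; linarith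
  have hp : poch (((k + m + 1 : ℕ) : ℝ) + k + α + β + 1) (m + 1) =
      poch a m * (a + m) * (a + m + 1) / a := by
    rw [eq_div_iff ha0.ne', show ((k + m + 1 : ℕ) : ℝ) + k + α + β + 1 = a + 1 by
      rw [ha]; push_cast; ring, mul_comm, ← poch_succ', poch_succ, poch_succ]
    push_cast
    ring
  have hP := (poch_pos ha0 m).ne'
  have hc' : ((k + m + 1).choose k : ℝ) = (k + m).choose k * (k + m + 1) / (m + 1) := by
    rw [eq_div_iff hm, hc]
  have ham : 2 * ((k + m : ℕ) : ℝ) + α + β + 1 = a + m := by rw [ha]; push_cast; ring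
  have ham' : 2 * ((k + m : ℕ) : ℝ) + α + β + 2 = a + m + 1 := by rw [ha]; push_cast; ring
  have hx : ((k + m : ℕ) : ℝ) + 1 - k = m + 1 := by push_cast; ring
  have h1 : a + m ≠ 0 := by positivity
  have h2 : a + m + 1 ≠ 0 := by positivity
  rw [racahCoeff, racahCoeff, e1, e2, hp, hc', ham, ham', hx, ← ha, poch_succ, poch_succ, poch_succ]
  push_cast
  field_simp
  ring

theorem racahCoeff_eq_succ_right {α β : ℝ} (h : 0 < α + β) (N δ : ℝ) {n k : ℕ} (hk : k < n) :
    racahCoeff α β N δ n k = -racahCoeff α β N δ n (k + 1) *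
      (((k + 1) / (n - k)) * ((k + α + 1) * (k + β + δ + 1) * (k - N)) /
        (n + k + α + β + 1)) := by
  obtain ⟨m, rfl⟩ := Nat.exists_eq_add_of_lt hk
  have hc : ((k + m + 1).choose k : ℝ) * (m + 1) = (k + m + 1).choose (k + 1) * (k + 1) := by
    have := Nat.choose_succ_right_eq (k + m + 1) k
    rw [show k + m + 1 - k = m + 1 by omega] at this
    exact_mod_cast this.symm
  have e1 : k + m + 1 - k = m + 1 := by omega
  have e2 : k + m + 1 - (k + 1) = m := by omega
  have hm : (m : ℝ) + 1 ≠ 0 := by positivity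
  have hkR : (0 : ℝ) ≤ k := by positivity
  have hmR : (0 : ℝ) ≤ m := by positivity
  set a : ℝ := (k + m + 1 : ℕ) + k + α + β + 1 with ha
  have ha0 : 0 < a := by rw [ha]; push_cast; linarith
  have hP := (poch_pos (a := a + 1) (by positivity) m).ne'
  have hc' : ((k + m + 1).choose k : ℝ) = (k + m + 1).choose (k + 1) * (k + 1) / (m + 1) := by
    rw [eq_div_iff hm, hc]
  have hx : ((k + m + 1 : ℕ) : ℝ) - k = m + 1 := by push_cast; ring
  have t1 : α + (k + 1 : ℕ) + 1 = α + k + 1 + 1 := by push_cast; ring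
  have t2 : β + δ + (k + 1 : ℕ) + 1 = β + δ + k + 1 + 1 := by push_cast; ring
  have t3 : ((k + 1 : ℕ) : ℝ) - N = k - N + 1 := by push_cast; ring
  have t4 : ((k + m + 1 : ℕ) : ℝ) + (k + 1 : ℕ) + α + β + 1 = a + 1 := by
    rw [ha]; push_cast; ring
  rw [racahCoeff, racahCoeff, e1, e2, t1, t2, t3, t4, hc', hx, ← ha, poch_succ', poch_succ',
    poch_succ', poch_succ']
  field_simp
  ring

theorem racahA_mul_racahCoeff {α β : ℝ} (h : 0 < α + β) (N δ : ℝ) {n k : ℕ} (hk : k ≤ n) :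
    racahA α β N δ n * racahCoeff α β N δ n k = racahCoeff α β N δ (n + 1) k *
      ((n + 1 - k) * (n + α + β + 1) / ((n + 1) * (n + k + α + β + 1))) := by
  have hkR : (k : ℝ) ≤ n := by exact_mod_cast hk
  have hn : (0 : ℝ) ≤ n := by positivity
  have hk0 : (0 : ℝ) ≤ k := by positivity
  have h₀ : (n : ℝ) + 1 - k ≠ 0 := by linarith
  have h₁ : (n : ℝ) + 1 ≠ 0 := by positivity
  have h₂ : (n : ℝ) + k + α + β + 1 ≠ 0 := by linarith
  have h₃ : 2 * (n : ℝ) + α + β + 1 ≠ 0 := by linarith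
  have h₄ : 2 * (n : ℝ) + α + β + 2 ≠ 0 := by linarith
  rw [racahCoeff_succ_left h N δ hk, racahA]
  generalize 2 * (n : ℝ) + α + β + 1 = u at *
  generalize 2 * (n : ℝ) + α + β + 2 = v at *
  generalize (n : ℝ) + k + α + β + 1 = w at *
  generalize (n : ℝ) + 1 - k = z at *
  field_simp

theorem racahCoeff_recurrence_zero {α β : ℝ} (h : 0 < α + β) (N δ : ℝ) (n : ℕ) :
    racahCoeff α β N δ (n + 2) 0 -
        (racahA α β N δ (n + 1) + racahC α β N δ (n + 1)) * racahCoeff α β N δ (n + 1) 0 +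
        racahA α β N δ n * racahC α β N δ (n + 1) * racahCoeff α β N δ n 0 = 0 := by
  rw [racahCoeff_succ_left h N δ (Nat.zero_le (n + 1)), racahCoeff_succ_left h N δ (Nat.zero_le n),
    racahA, racahA, racahC]
  have hn : (0 : ℝ) ≤ n := by positivity
  have hn1 : (n : ℝ) + 1 ≠ 0 := by positivity
  have hn2 : (n : ℝ) + 1 + 1 ≠ 0 := by positivity
  push_cast
  have d1 : 2 * (n : ℝ) + α + β + 1 ≠ 0 := by linarith
  have d2 : 2 * (n : ℝ) + α + β + 2 ≠ 0 := by linarith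
  have d3 : 2 * ((n : ℝ) + 1) + α + β + 1 ≠ 0 := by linarith
  have d4 : 2 * ((n : ℝ) + 1) + α + β + 2 ≠ 0 := by linarith
  have d5 : 2 * ((n : ℝ) + 1) + α + β ≠ 0 := by linarith
  simp only [sub_zero, add_zero]
  field_simp
  ring

theorem racahA_increment {α β n k : ℝ} (G : ℝ) (h₁ : n + 1 - k ≠ 0)
    (h₂ : 2 * (n + 1) + α + β + 1 ≠ 0) (h₃ : 2 * (n + 1) + α + β + 2 ≠ 0) :
    (n + 1 + 1) / (n + 1 - k) * G * ((n + 1 + (k + 1) + α + β + 1) /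
        ((2 * (n + 1) + α + β + 1) * (2 * (n + 1) + α + β + 2))) -
      (n + 1 + α + β + 1) * G / ((2 * (n + 1) + α + β + 1) * (2 * (n + 1) + α + β + 2)) =
    (k + 1) * (G / ((n + 1 - k) * (2 * (n + 1) + α + β + 1))) := by
  generalize hu : n + 1 - k = u at *
  generalize hv : 2 * (n + 1) + α + β + 1 = v at *
  generalize hw : 2 * (n + 1) + α + β + 2 = w at *
  field_simp
  subst u v w
  ring

theorem racahC_increment {α β n k : ℝ} (G : ℝ) (h₀ : n + 1 ≠ 0) (h₁ : n + 1 + k + α + β + 1 ≠ 0)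
    (h₂ : 2 * (n + 1) + α + β + 1 ≠ 0) (h₃ : 2 * (n + 1) + α + β ≠ 0) :
    (n + 1) * G / ((2 * (n + 1) + α + β) * (2 * (n + 1) + α + β + 1)) -
      (n + 1) * G / ((2 * (n + 1) + α + β) * (2 * (n + 1) + α + β + 1)) *
        ((n - k) * (n + α + β + 1) / ((n + 1) * (n + 1 + k + α + β + 1))) =
    (k + 1) * (G / ((2 * (n + 1) + α + β + 1) * (n + 1 + k + α + β + 1))) := by
  generalize hu : n + 1 + k + α + β + 1 = u at *
  generalize hv : 2 * (n + 1) + α + β + 1 = v at *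
  generalize hw : 2 * (n + 1) + α + β = w at *
  field_simp
  subst u v w
  ring

theorem racah_node_identity {α β n k : ℝ} (N δ : ℝ) (h₀ : n + 1 - k ≠ 0)
    (h₁ : n + 1 + k + α + β + 1 ≠ 0) (h₂ : 2 * (n + 1) + α + β + 1 ≠ 0) :
    k + 1 + δ - N + (k + α + 1) * (k + β + δ + 1) * (k - N) /
        ((n + 1 - k) * (n + 1 + k + α + β + 1)) =
      (n + 1 + α + 1) * (n + 1 + β + δ + 1) * (n + 1 - N) /
        ((n + 1 - k) * (2 * (n + 1) + α + β + 1)) -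
      (n + 1 + α + β + N + 1) * (n + 1 + α - δ) * (n + 1 + β) /
        ((2 * (n + 1) + α + β + 1) * (n + 1 + k + α + β + 1)) := by
  generalize hu : n + 1 - k = u at *
  generalize hv : n + 1 + k + α + β + 1 = v at *
  generalize hw : 2 * (n + 1) + α + β + 1 = w at *
  field_simp
  subst u v w
  ring

theorem racahCoeff_recurrence_succ {α β : ℝ} (h : 0 < α + β) (N δ : ℝ) {n k : ℕ}
    (hk : k < n + 2) :
    (k + 1) * (k + 1 + δ - N) * racahCoeff α β N δ (n + 1) (k + 1) -
        racahCoeff α β N δ (n + 1) k =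
      racahCoeff α β N δ (n + 2) (k + 1) -
        (racahA α β N δ (n + 1) + racahC α β N δ (n + 1)) * racahCoeff α β N δ (n + 1) (k + 1) +
        racahA α β N δ n * racahC α β N δ (n + 1) * racahCoeff α β N δ n (k + 1) := by
  have hn : (0 : ℝ) ≤ n := by positivity
  have hn1 : (n : ℝ) + 1 ≠ 0 := by positivity
  have hn2 : (n : ℝ) + 1 + 1 ≠ 0 := by positivity
  have d1 : 2 * (n : ℝ) + α + β + 1 ≠ 0 := by linarith
  have d2 : 2 * (n : ℝ) + α + β + 2 ≠ 0 := by linarith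
  have d3 : 2 * ((n : ℝ) + 1) + α + β + 1 ≠ 0 := by linarith
  have d4 : 2 * ((n : ℝ) + 1) + α + β + 2 ≠ 0 := by linarith
  have d5 : 2 * ((n : ℝ) + 1) + α + β ≠ 0 := by linarith
  rcases lt_trichotomy k n with hkn | rfl | hkn
  · have hkn' : (k : ℝ) < n := by exact_mod_cast hkn
    have hk0 : (0 : ℝ) ≤ k := by positivity
    have g1 : (n : ℝ) - k ≠ 0 := by linarith
    have g2 : (n : ℝ) + 1 - k ≠ 0 := by linarith
    have g3 : (n : ℝ) + 1 + k + α + β + 1 ≠ 0 := by linarith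
    have hsub : ((n + 1 : ℕ) : ℝ) + 1 - (k + 1 : ℕ) = n + 1 - k := by push_cast; ring
    have hsub' : (n : ℝ) + 1 - (k + 1 : ℕ) = n - k := by push_cast; ring
    have hA : racahA α β N δ n * racahCoeff α β N δ n (k + 1) =
        racahCoeff α β N δ (n + 1) (k + 1) *
          ((n - k) * (n + α + β + 1) / ((n + 1) * (n + 1 + k + α + β + 1))) := by
      rw [racahA_mul_racahCoeff h N δ hkn, hsub', Nat.cast_succ, add_right_comm (n : ℝ) 1 k,
        add_assoc (n : ℝ) k 1]
    have eA := racahA_increment (k := k) ((n + 1 + α + 1) * (n + 1 + β + δ + 1) * (n + 1 - N))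
      g2 d3 d4
    have eC := racahC_increment (k := k) ((n + 1 + α + β + N + 1) * (n + 1 + α - δ) * (n + 1 + β))
      hn1 g3 d3 d5
    have eK := racah_node_identity N δ g2 g3 d3
    have hA' : racahA α β N δ (n + 1) = (n + 1 + α + β + 1) *
        ((n + 1 + α + 1) * (n + 1 + β + δ + 1) * (n + 1 - N)) /
          ((2 * (n + 1) + α + β + 1) * (2 * (n + 1) + α + β + 2)) := by
      rw [racahA]
      push_cast
      congr 1
      ring
    have hC' : racahC α β N δ (n + 1) = (n + 1) *
        ((n + 1 + α + β + N + 1) * (n + 1 + α - δ) * (n + 1 + β)) /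
          ((2 * (n + 1) + α + β) * (2 * (n + 1) + α + β + 1)) := by
      rw [racahC]
      push_cast
      congr 1
      ring
    rw [← hA'] at eA
    rw [← hC'] at eC
    have eR : ((k : ℝ) + 1) / (n + 1 - k) * ((k + α + 1) * (k + β + δ + 1) * (k - N)) /
        (n + 1 + k + α + β + 1) = (k + 1) * ((k + α + 1) * (k + β + δ + 1) * (k - N) /
          ((n + 1 - k) * (n + 1 + k + α + β + 1))) := by
      field_simp
    rw [racahCoeff_eq_succ_right h N δ (show k < n + 1 by omega),
      racahCoeff_succ_left h N δ (show k + 1 ≤ n + 1 by omega), mul_right_comm (racahA α β N δ n),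
      hA, hsub]
    push_cast
    rw [eR]
    linear_combination racahCoeff α β N δ (n + 1) (k + 1) * ((k + 1) * eK - eA + eC)
  · rw [racahCoeff_eq_succ_right h N δ (show k < k + 1 by omega),
      racahCoeff_succ_left h N δ (show k + 1 ≤ k + 1 by omega),
      racahCoeff_eq_zero α β N δ (show k < k + 1 by omega), racahA, racahA, racahC]
    push_cast at *
    have g2 : ((k : ℝ) + 1 + 1 - (k + 1)) = 1 := by ring
    have g3 : ((k : ℝ) + 1 - k) = 1 := by ring
    have g4 : ((k : ℝ) + 1 + k + α + β + 1) ≠ 0 := by linarith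
    rw [g2, g3]
    generalize hu : (k : ℝ) + 1 + k + α + β + 1 = u at *
    generalize hv : 2 * ((k : ℝ) + 1) + α + β + 1 = v at *
    generalize hw : 2 * ((k : ℝ) + 1) + α + β + 2 = w at *
    generalize hz : 2 * ((k : ℝ) + 1) + α + β = z at *
    field_simp
    subst u v w z
    ring
  · obtain rfl : k = n + 1 := by omega
    rw [racahCoeff_eq_zero α β N δ (show n + 1 < n + 1 + 1 by omega),
      racahCoeff_eq_zero α β N δ (show n < n + 1 + 1 by omega), racahCoeff_self, racahCoeff_self]
    ring

theorem racahBasis_succ (N δ : ℝ) (k : ℕ) (y : ℝ) :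
    racahBasis N δ (k + 1) y = racahBasis N δ k y * (k * (k + δ - N) - y) := by
  simp [racahBasis, Finset.prod_range_succ]

/-- The three-term recurrence of the monic Racah polynomials. -/
theorem monicRacah_succ_succ {α β : ℝ} (h : 0 < α + β) (N δ : ℝ) (n : ℕ) (y : ℝ) :
    monicRacah α β N δ (n + 2) y =
      (y + racahA α β N δ (n + 1) + racahC α β N δ (n + 1)) * monicRacah α β N δ (n + 1) y -
        racahA α β N δ n * racahC α β N δ (n + 1) * monicRacah α β N δ n y := by
  set c := racahCoeff α β N δ
  set φ := fun k => racahBasis N δ k y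
  have hy : y * monicRacah α β N δ (n + 1) y =
      ∑ k ∈ Finset.range (n + 2), ((k + 1) * (k + 1 + δ - N) * c (n + 1) (k + 1) -
        c (n + 1) k) * φ (k + 1) := by
    have hsplit : ∑ k ∈ Finset.range (n + 2), (k + 1) * (k + 1 + δ - N) * c (n + 1) (k + 1) *
        φ (k + 1) = ∑ k ∈ Finset.range (n + 2), k * (k + δ - N) * c (n + 1) k * φ k := by
      have h1 := Finset.sum_range_succ'
        (fun k : ℕ => (k : ℝ) * (k + δ - N) * c (n + 1) k * φ k) (n + 2)
      rw [Finset.sum_range_succ] at h1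
      simp only [c, racahCoeff_eq_zero α β N δ (show n + 1 < n + 2 by omega)] at h1 ⊢
      push_cast at h1
      linarith
    simp only [sub_mul, Finset.sum_sub_distrib]
    rw [hsplit, ← Finset.sum_sub_distrib, monicRacah_eq_sum h, Finset.mul_sum]
    refine Finset.sum_congr rfl fun k _ => ?_
    simp only [φ, racahBasis_succ]
    ring
  have hext : ∀ m ≤ n + 2, monicRacah α β N δ m y =
      ∑ k ∈ Finset.range (n + 2), c m (k + 1) * φ (k + 1) + c m 0 * φ 0 := by
    intro m hm
    rw [monicRacah_eq_sum h, ← Finset.sum_range_succ' (fun k => c m k * φ k)]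
    refine Finset.sum_subset (Finset.range_mono (by omega)) fun k _ hk => ?_
    rw [Finset.mem_range, not_lt] at hk
    simp [racahCoeff_eq_zero α β N δ (show m < k by omega)]
  have hsum : y * monicRacah α β N δ (n + 1) y =
      ∑ k ∈ Finset.range (n + 2), (c (n + 2) (k + 1) -
        (racahA α β N δ (n + 1) + racahC α β N δ (n + 1)) * c (n + 1) (k + 1) +
        racahA α β N δ n * racahC α β N δ (n + 1) * c n (k + 1)) * φ (k + 1) := by
    rw [hy]
    refine Finset.sum_congr rfl fun k hk => ?_
    rw [racahCoeff_recurrence_succ h N δ (Finset.mem_range.1 hk)]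
  have h0 := racahCoeff_recurrence_zero h N δ n
  simp only [add_mul, sub_mul, Finset.sum_add_distrib, Finset.sum_sub_distrib] at hsum
  simp only [mul_assoc, ← Finset.mul_sum] at hsum
  rw [add_assoc, add_mul, hsum, hext (n + 2) le_rfl, hext (n + 1) (by omega), hext n (by omega)]
  linear_combination φ 0 * h0

theorem monicRacah_zero (α β N δ y : ℝ) : monicRacah α β N δ 0 y = 1 := by
  simp [monicRacah, poch]

theorem monicRacah_one {α β : ℝ} (h : 0 < α + β) (N δ y : ℝ) :
    monicRacah α β N δ 1 y = y + racahA α β N δ 0 := by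
  have h1 : α + β + 1 ≠ 0 := by linarith
  have h2 : α + β + 2 ≠ 0 := by linarith
  have h3 : 1 + α + β + 1 ≠ 0 := by linarith
  simp [monicRacah, poch, Finset.sum_range_succ, racahA]
  field_simp
  ring

/-- The `m`-th summand of the monic Hermite polynomial, extended by zero. -/
noncomputable def hermiteTerm (x : ℝ) (n m : ℕ) : ℝ :=
  if 2 * m ≤ n then
    (-1) ^ m * n.factorial * x ^ (n - 2 * m) / (4 ^ m * m.factorial * (n - 2 * m).factorial)
  else 0

theorem monicHermite_eq_sum (x : ℝ) {n M : ℕ} (h : n / 2 + 1 ≤ M) :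
    monicHermite n x = ∑ m ∈ Finset.range M, hermiteTerm x n m := by
  rw [monicHermite, Finset.mul_sum]
  refine (Finset.sum_congr rfl fun m hm => ?_).trans
    (Finset.sum_subset (Finset.range_mono h) fun m _ hm => ?_)
  · have := Finset.mem_range.1 hm
    rw [hermiteTerm, if_pos (by omega)]
    ring
  · rw [Finset.mem_range] at hm
    rw [hermiteTerm, if_neg (by omega)]

theorem hermiteTerm_zero (x : ℝ) (n : ℕ) : hermiteTerm x n 0 = x ^ n := by
  have : (n.factorial : ℝ) ≠ 0 := by positivity
  simp [hermiteTerm]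
  field_simp

theorem hermiteTerm_succ_succ (x : ℝ) (n m : ℕ) :
    hermiteTerm x (n + 2) (m + 1) =
      x * hermiteTerm x (n + 1) (m + 1) - (n + 1) / 2 * hermiteTerm x n m := by
  rcases le_or_gt (2 * m) n with h | h
  · obtain ⟨j, rfl⟩ := Nat.exists_eq_add_of_le h
    rw [hermiteTerm, hermiteTerm, hermiteTerm, if_pos (by omega), if_pos h,
      show 2 * m + j + 2 - 2 * (m + 1) = j by omega, show 2 * m + j - 2 * m = j by omega]
    have h0 : ((2 * m + j).factorial : ℝ) ≠ 0 := by positivity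
    have h1 : (m.factorial : ℝ) ≠ 0 := by positivity
    have h2 : (j.factorial : ℝ) ≠ 0 := by positivity
    rcases j with _ | j
    · rw [if_neg (by omega)]
      simp only [Nat.factorial_succ, add_zero]
      push_cast
      field_simp
      ring
    · rw [if_pos (by omega), show 2 * m + (j + 1) + 1 - 2 * (m + 1) = j by omega]
      have h3 : (j.factorial : ℝ) ≠ 0 := by positivity
      rw [Nat.factorial_succ (2 * m + (j + 1) + 1), Nat.factorial_succ (2 * m + (j + 1)),
        Nat.factorial_succ j, Nat.factorial_succ m]
      push_cast
      field_simp
      ring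
  · rw [hermiteTerm, hermiteTerm, hermiteTerm, if_neg (by omega), if_neg (by omega),
      if_neg (by omega)]
    ring

/-- The three-term recurrence of the monic Hermite polynomials. -/
theorem monicHermite_succ_succ (n : ℕ) (x : ℝ) :
    monicHermite (n + 2) x = x * monicHermite (n + 1) x - (n + 1) / 2 * monicHermite n x := by
  rw [monicHermite_eq_sum x (show (n + 2) / 2 + 1 ≤ n + 3 by omega),
    monicHermite_eq_sum x (show (n + 1) / 2 + 1 ≤ n + 3 by omega),
    monicHermite_eq_sum x (show n / 2 + 1 ≤ n + 2 by omega),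
    Finset.sum_range_succ', Finset.sum_range_succ' _ (n + 2)]
  simp only [hermiteTerm_zero, hermiteTerm_succ_succ, Finset.sum_sub_distrib, mul_add,
    Finset.mul_sum]
  ring

theorem sqrt_two_pow_mul_monicHermite_succ_succ (n : ℕ) (x : ℝ) :
    √2 ^ (n + 2) * monicHermite (n + 2) (x / √2) =
      x * (√2 ^ (n + 1) * monicHermite (n + 1) (x / √2)) -
        (n + 1) * (√2 ^ n * monicHermite n (x / √2)) := by
  have h0 : √2 ≠ 0 := by positivity
  have h2 : √2 ^ 2 = 2 := Real.sq_sqrt (by norm_num)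
  have hx : x = x / √2 * √2 := by field_simp
  rw [monicHermite_succ_succ, pow_add √2 n 2, h2]
  set z := x / √2
  rw [hx]
  linear_combination (-z * √2 ^ n * monicHermite (n + 1) z) * h2

/-- `f` tends to `1` faster than `κ` grows. -/
def TendsToOneRel {ι : Type*} (l : Filter ι) (κ f : ι → ℝ) : Prop :=
  Tendsto f l (nhds 1) ∧ Tendsto (fun i => κ i * (f i - 1)) l (nhds 0)

namespace TendsToOneRel

variable {ι : Type*} {l : Filter ι} {κ f g : ι → ℝ}

theorem mul (hf : TendsToOneRel l κ f) (hg : TendsToOneRel l κ g) :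
    TendsToOneRel l κ (fun i => f i * g i) := by
  refine ⟨by simpa using hf.1.mul hg.1, ?_⟩
  have := (hf.2.mul hg.1).add hg.2
  simp only [zero_mul, add_zero] at this
  exact this.congr fun i => by ring

theorem inv (hf : TendsToOneRel l κ f) : TendsToOneRel l κ (fun i => (f i)⁻¹) := by
  have h1 : Tendsto (fun i => (f i)⁻¹) l (nhds 1) := by simpa using hf.1.inv₀ one_ne_zero
  refine ⟨h1, ?_⟩
  have := (hf.2.mul h1).neg
  simp only [zero_mul, neg_zero] at this
  refine this.congr' ?_
  filter_upwards [hf.1.eventually_ne one_ne_zero] with i hi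
  field_simp
  ring

theorem one_add_div {Y : ι → ℝ} (c : ℝ) (hY : Tendsto Y l atTop)
    (h : Tendsto (fun i => κ i / Y i) l (nhds 0)) :
    TendsToOneRel l κ (fun i => 1 + c / Y i) := by
  refine ⟨by simpa using (hY.const_div_atTop c).const_add 1, ?_⟩
  have := h.const_mul c
  rw [mul_zero] at this
  exact this.congr fun i => by ring

end TendsToOneRel

theorem tendsto_zero_of_sq_le {ι : Type*} {l : Filter ι} {f g : ι → ℝ}
    (h : ∀ᶠ i in l, f i ^ 2 ≤ g i) (hg : Tendsto g l (nhds 0)) : Tendsto f l (nhds 0) := by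
  have hs : Tendsto (fun i => √(g i)) l (nhds 0) := by simpa using hg.sqrt
  exact squeeze_zero_norm' (h.mono fun i hi => by simpa using Real.abs_le_sqrt hi) hs

/-- The factor by which `racahA` differs from its leading behaviour. -/
noncomputable def racahAFactor (α β N δ : ℝ) (n : ℕ) : ℝ :=
  (1 + (n + 1) / α) * (1 + (n + 1) / (α + β)) * (1 + (n + 1) / (β + δ)) * (1 + -n / N) *
    (1 + (2 * n + 1) / (α + β))⁻¹ * (1 + (2 * n + 2) / (α + β))⁻¹

/-- The factor by which `racahC` differs from its leading behaviour. -/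
noncomputable def racahCFactor (α β N δ : ℝ) (n : ℕ) : ℝ :=
  (1 + (n + 1) / (N + α + β)) * (1 + -n / (δ - α)) * (1 + n / β) *
    (1 + 2 * n / (α + β))⁻¹ * (1 + (2 * n + 1) / (α + β))⁻¹

theorem add_eq_mul_one_add_div {a : ℝ} (ha : a ≠ 0) (c : ℝ) : a + c = a * (1 + c / a) := by
  field_simp

theorem racahA_eq {α β N δ : ℝ} (hα : α ≠ 0) (hαβ : α + β ≠ 0) (hβδ : β + δ ≠ 0) (hN : N ≠ 0)
    (n : ℕ) :
    racahA α β N δ n = -(α * (β + δ) * N / (α + β)) * racahAFactor α β N δ n := by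
  rw [racahA, racahAFactor, show n + α + 1 = α + (n + 1) by ring,
    show n + α + β + 1 = α + β + (n + 1) by ring, show n + β + δ + 1 = β + δ + (n + 1) by ring,
    show n - N = -(N + -n) by ring, show 2 * n + α + β + 1 = α + β + (2 * n + 1) by ring,
    show 2 * n + α + β + 2 = α + β + (2 * n + 2) by ring,
    add_eq_mul_one_add_div hα, add_eq_mul_one_add_div hαβ, add_eq_mul_one_add_div hβδ,
    add_eq_mul_one_add_div hN, add_eq_mul_one_add_div hαβ, add_eq_mul_one_add_div hαβ,
    div_eq_mul_inv, mul_inv, mul_inv, mul_inv]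
  generalize (1 + (2 * (n : ℝ) + 1) / (α + β))⁻¹ = u
  generalize (1 + (2 * (n : ℝ) + 2) / (α + β))⁻¹ = v
  generalize 1 + ((n : ℝ) + 1) / (α + β) = w
  generalize α + β = s at *
  generalize 1 + ((n : ℝ) + 1) / α = w1
  generalize β + δ = t at *
  generalize 1 + ((n : ℝ) + 1) / t = w2
  generalize 1 + (-(n : ℝ)) / N = w3
  field_simp

theorem racahC_eq {α β N δ : ℝ} (hβ : β ≠ 0) (hαβ : α + β ≠ 0) (hδα : δ - α ≠ 0)
    (hN : N + α + β ≠ 0) (n : ℕ) :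
    racahC α β N δ n =
      -((N + α + β) * (δ - α) * β / (α + β) ^ 2) * (n * racahCFactor α β N δ n) := by
  rw [racahC, racahCFactor, show n + α + β + N + 1 = N + α + β + (n + 1) by ring,
    show n + α - δ = -(δ - α + -n) by ring, show n + β = β + n by ring,
    show 2 * n + α + β + 1 = α + β + (2 * n + 1) by ring,
    show 2 * n + α + β = α + β + 2 * n by ring,
    add_eq_mul_one_add_div hN, add_eq_mul_one_add_div hδα, add_eq_mul_one_add_div hβ,
    add_eq_mul_one_add_div hαβ, add_eq_mul_one_add_div hαβ,
    div_eq_mul_inv, mul_inv, mul_inv, mul_inv]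
  generalize (1 + (2 * (n : ℝ) + 1) / (α + β))⁻¹ = u
  generalize (1 + 2 * (n : ℝ) / (α + β))⁻¹ = v
  generalize 1 + ((n : ℝ) + 1) / (N + α + β) = w
  generalize N + α + β = t at *
  generalize α + β = s at *
  generalize δ - α = r at *
  generalize 1 + -(n : ℝ) / r = w1
  generalize 1 + (n : ℝ) / β = w2
  field_simp

/-- The scaling `ρ` times the leading behaviour of `-racahA`. -/
noncomputable def racahKappa (α b d ν : ℝ) : ℝ :=
  racahRho α b d ν *
    (α * (b * α + (b * d * ν + 1) * α) * (b * ν) / (α + b * α))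

/-- The scaling `ρ` times the leading behaviour of `-racahC`. -/
noncomputable def racahLambda (α b d ν : ℝ) : ℝ :=
  racahRho α b d ν * ((b * ν + α + b * α) * ((b * d * ν + 1) * α - α) * (b * α) /
    (α + b * α) ^ 2)

section Estimates

variable {α b d ν : ℝ}

theorem racahRho_sq (hα : 0 < α) (hb : 0 < b) (hd : 0 < d) (hν : 0 < ν) :
    racahRho α b d ν ^ 2 = (α * (1 + b)) ^ 3 / (α * (b * α) * (α * (b + b * d * ν + 1)) *
      (b * ν + α + b * α) * (b * d * ν * α) * (b * ν)) := by
  rw [racahRho, show α + b * α = α * (1 + b) by ring,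
    show b * α + (b * d * ν + 1) * α = α * (b + b * d * ν + 1) by ring,
    show (b * d * ν + 1) * α - α = b * d * ν * α by ring, Real.sq_sqrt (by positivity)]

theorem racahRho_pos (hα : 0 < α) (hb : 0 < b) (hd : 0 < d) (hν : 0 < ν) :
    0 < racahRho α b d ν := by
  have h : 0 < racahRho α b d ν ^ 2 := by
    rw [racahRho_sq hα hb hd hν]
    positivity
  exact lt_of_le_of_ne (Real.sqrt_nonneg _) fun h0 => by
    change 0 = racahRho α b d ν at h0
    simp [← h0] at h

theorem racahKappa_sq (hα : 0 < α) (hb : 0 < b) (hd : 0 < d) (hν : 0 < ν) :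
    racahKappa α b d ν ^ 2 = (1 + b) / b * ((b + b * d * ν + 1) / (b * d * ν)) *
      (α * (b * ν) / (b * ν + α + b * α)) := by
  rw [racahKappa, mul_pow, racahRho_sq hα hb hd hν,
    show b * α + (b * d * ν + 1) * α = α * (b + b * d * ν + 1) by ring,
    show α + b * α = α * (1 + b) by ring]
  field_simp

theorem racahKappa_mul_racahLambda (hα : 0 < α) (hb : 0 < b) (hd : 0 < d) (hν : 0 < ν) :
    racahKappa α b d ν * racahLambda α b d ν = 1 := by
  rw [racahKappa, racahLambda, mul_mul_mul_comm, ← sq, racahRho_sq hα hb hd hν,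
    show b * α + (b * d * ν + 1) * α = α * (b + b * d * ν + 1) by ring,
    show (b * d * ν + 1) * α - α = b * d * ν * α by ring,
    show α + b * α = α * (1 + b) by ring]
  field_simp

theorem racahLambda_sq_le (hα : 0 < α) (hb : 0 < b) (hd : 0 < d) (hν : 0 < ν) :
    racahLambda α b d ν ^ 2 ≤ 1 / α + 1 / (b * ν) + 1 / ν := by
  have h1 : b / (1 + b) * (b * d * ν / (b + b * d * ν + 1)) ≤ 1 :=
    mul_le_one₀ ((div_le_one (by positivity)).2 (by linarith)) (by positivity)
      ((div_le_one (by positivity)).2 (by linarith))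
  have h2 : racahLambda α b d ν ^ 2 = b / (1 + b) * (b * d * ν / (b + b * d * ν + 1)) *
      (1 / α + 1 / (b * ν) + 1 / ν) := by
    rw [racahLambda, mul_pow, racahRho_sq hα hb hd hν,
      show (b * d * ν + 1) * α - α = b * d * ν * α by ring,
      show α + b * α = α * (1 + b) by ring]
    field_simp
  rw [h2]
  exact mul_le_of_le_one_left (by positivity) h1

theorem racahKappa_sq_le (hα : 0 < α) (hb : 1 ≤ b) (hd : 1 ≤ d) (hν : 1 ≤ ν) :
    racahKappa α b d ν ^ 2 ≤ 6 * (α * (b * ν) / (b * ν + α + b * α)) := by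
  have hb0 : 0 < b := by linarith
  have hd0 : 0 < d := by linarith
  have hν0 : 0 < ν := by linarith
  have hdν : 1 ≤ d * ν := one_le_mul_of_one_le_of_one_le hd hν
  rw [racahKappa_sq hα hb0 hd0 hν0]
  refine mul_le_mul_of_nonneg_right ?_ (by positivity)
  have h1 : (1 + b) / b ≤ 2 := (div_le_iff₀ hb0).2 (by linarith)
  have h2 : (b + b * d * ν + 1) / (b * d * ν) ≤ 3 :=
    (div_le_iff₀ (by positivity)).2 (by nlinarith)
  calc (1 + b) / b * ((b + b * d * ν + 1) / (b * d * ν)) ≤ 2 * 3 :=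
        mul_le_mul h1 h2 (by positivity) (by norm_num)
    _ = 6 := by norm_num

theorem racahKappa_div_alpha_sq_le (hα : 0 < α) (hb : 1 ≤ b) (hd : 1 ≤ d) (hν : 1 ≤ ν) :
    (racahKappa α b d ν / α) ^ 2 ≤ 6 / α := by
  have hb0 : 0 < b := by linarith
  have hν0 : 0 < ν := by linarith
  rw [div_pow, div_le_iff₀ (by positivity)]
  refine (racahKappa_sq_le hα hb hd hν).trans ?_
  rw [show 6 / α * α ^ 2 = 6 * α by field_simp]
  refine mul_le_mul_of_nonneg_left ?_ (by norm_num)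
  rw [div_le_iff₀ (by positivity)]
  exact mul_le_mul_of_nonneg_left (by nlinarith) hα.le

theorem racahKappa_div_sq_le (hα : 0 < α) (hb : 1 ≤ b) (hd : 1 ≤ d) (hν : 1 ≤ ν) :
    (racahKappa α b d ν / (b * ν)) ^ 2 ≤ 6 / (b * ν) := by
  have hb0 : 0 < b := by linarith
  have hν0 : 0 < ν := by linarith
  rw [div_pow, div_le_iff₀ (by positivity)]
  refine (racahKappa_sq_le hα hb hd hν).trans ?_
  rw [show 6 / (b * ν) * (b * ν) ^ 2 = 6 * (b * ν) by field_simp]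
  refine mul_le_mul_of_nonneg_left ?_ (by norm_num)
  rw [div_le_iff₀ (by positivity), mul_comm α]
  exact mul_le_mul_of_nonneg_left (by nlinarith) (by positivity)

theorem racahKappa_pos (hα : 0 < α) (hb : 0 < b) (hd : 0 < d) (hν : 0 < ν) :
    0 < racahKappa α b d ν := by
  have := racahRho_pos hα hb hd hν
  rw [racahKappa]
  positivity

theorem racahSigma_eq (hα : 0 < α) (hb : 0 < b) :
    racahSigma α b d ν = racahA α (b * α) (b * ν) ((b * d * ν + 1) * α) 0 := by
  have : 0 < b * α := by positivity
  have h1 : α + b * α + 1 ≠ 0 := by positivity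
  have h2 : α + b * α + 2 ≠ 0 := by positivity
  rw [racahSigma, racahA]
  simp only [Nat.cast_zero, zero_add, mul_zero]
  generalize α + b * α + 1 = u at *
  generalize α + b * α + 2 = v at *
  field_simp
  ring

theorem rescaledRacah_zero (x : ℝ) : rescaledRacah α b d ν 0 x = 1 := by
  simp [rescaledRacah, monicRacah_zero]

theorem rescaledRacah_one (hα : 0 < α) (hb : 0 < b) (hd : 0 < d) (hν : 0 < ν) (x : ℝ) :
    rescaledRacah α b d ν 1 x = x := by
  have hρ := racahRho_pos hα hb hd hν
  rw [rescaledRacah, monicRacah_one (by positivity), racahSigma_eq hα hb]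
  field_simp
  ring

/-- The three-term recurrence of the rescaled monic Racah polynomials. -/
theorem rescaledRacah_succ_succ (hα : 0 < α) (hb : 0 < b) (hd : 0 < d) (hν : 0 < ν) (n : ℕ)
    (x : ℝ) :
    rescaledRacah α b d ν (n + 2) x =
      (x - (racahKappa α b d ν *
            (racahAFactor α (b * α) (b * ν) ((b * d * ν + 1) * α) (n + 1) -
              racahAFactor α (b * α) (b * ν) ((b * d * ν + 1) * α) 0) +
          racahLambda α b d ν * ((n + 1) *
            racahCFactor α (b * α) (b * ν) ((b * d * ν + 1) * α) (n + 1)))) *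
        rescaledRacah α b d ν (n + 1) x -
      racahAFactor α (b * α) (b * ν) ((b * d * ν + 1) * α) n * ((n + 1) *
        racahCFactor α (b * α) (b * ν) ((b * d * ν + 1) * α) (n + 1)) *
        rescaledRacah α b d ν n x := by
  have hρ := racahRho_pos hα hb hd hν
  have hδα : (b * d * ν + 1) * α - α ≠ 0 := by
    rw [show (b * d * ν + 1) * α - α = b * d * ν * α by ring]
    positivity
  have hA : ∀ m, racahRho α b d ν * racahA α (b * α) (b * ν) ((b * d * ν + 1) * α) m =
      -racahKappa α b d ν * racahAFactor α (b * α) (b * ν) ((b * d * ν + 1) * α) m := fun m => by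
    rw [racahA_eq (by positivity) (by positivity) (by positivity) (by positivity), racahKappa]
    ring
  have hC : racahRho α b d ν * racahC α (b * α) (b * ν) ((b * d * ν + 1) * α) (n + 1) =
      -racahLambda α b d ν * ((n + 1) *
        racahCFactor α (b * α) (b * ν) ((b * d * ν + 1) * α) (n + 1)) := by
    rw [racahC_eq (by positivity) (by positivity) hδα (by positivity), racahLambda]
    push_cast
    ring
  have hκ := racahKappa_mul_racahLambda hα hb hd hν
  have hx : racahRho α b d ν * (x / racahRho α b d ν) = x := by field_simp
  simp only [rescaledRacah]
  rw [monicRacah_succ_succ (by positivity), racahSigma_eq hα hb]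
  have hA0 := hA 0
  have hA1 := hA (n + 1)
  have hAn := hA n
  set ρ := racahRho α b d ν
  set r₀ := monicRacah α (b * α) (b * ν) ((b * d * ν + 1) * α) n
    (x / ρ - racahA α (b * α) (b * ν) ((b * d * ν + 1) * α) 0)
  set r₁ := monicRacah α (b * α) (b * ν) ((b * d * ν + 1) * α) (n + 1)
    (x / ρ - racahA α (b * α) (b * ν) ((b * d * ν + 1) * α) 0)
  generalize racahA α (b * α) (b * ν) ((b * d * ν + 1) * α) 0 = A0 at *
  generalize racahA α (b * α) (b * ν) ((b * d * ν + 1) * α) (n + 1) = A1 at *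
  generalize racahA α (b * α) (b * ν) ((b * d * ν + 1) * α) n = An at *
  generalize racahC α (b * α) (b * ν) ((b * d * ν + 1) * α) (n + 1) = C at *
  generalize racahAFactor α (b * α) (b * ν) ((b * d * ν + 1) * α) n = Fn at *
  generalize racahCFactor α (b * α) (b * ν) ((b * d * ν + 1) * α) (n + 1) = G at *
  linear_combination ρ ^ (n + 1) * r₁ * (hx - hA0 + hA1 + hC) -
    ρ ^ n * r₀ * (hAn * (ρ * C) - racahKappa α b d ν * Fn * hC + Fn * ((n + 1) * G) * hκ)

end Estimates

section Limit

variable {ι : Type*} {l : Filter ι} {α b d ν : ι → ℝ}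

theorem tendsto_rescaledRacah (hα : Tendsto α l atTop) (hb : Tendsto b l atTop)
    (hd : Tendsto d l atTop) (hν : Tendsto ν l atTop) (x : ℝ) (n : ℕ) :
    Tendsto (fun i => rescaledRacah (α i) (b i) (d i) (ν i) n x) l
      (nhds (√2 ^ n * monicHermite n (x / √2))) := by
  set κ : ι → ℝ := fun i => racahKappa (α i) (b i) (d i) (ν i)
  have hev : ∀ᶠ i in l, 1 ≤ α i ∧ 1 ≤ b i ∧ 1 ≤ d i ∧ 1 ≤ ν i :=
    (hα.eventually_ge_atTop 1).and ((hb.eventually_ge_atTop 1).and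
      ((hd.eventually_ge_atTop 1).and (hν.eventually_ge_atTop 1)))
  have hβ : Tendsto (fun i => b i * α i) l atTop := hb.atTop_mul_atTop₀ hα
  have hN : Tendsto (fun i => b i * ν i) l atTop := hb.atTop_mul_atTop₀ hν
  have hδα : Tendsto (fun i => (b i * d i * ν i + 1) * α i - α i) l atTop :=
    (((hb.atTop_mul_atTop₀ hd).atTop_mul_atTop₀ hν).atTop_mul_atTop₀ hα).congr fun i => by ring
  have hαβ : Tendsto (fun i => α i + b i * α i) l atTop := hα.atTop_add_atTop hβ
  have hNαβ : Tendsto (fun i => b i * ν i + α i + b i * α i) l atTop :=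
    (hN.atTop_add_atTop hα).atTop_add_atTop hβ
  have hβδ : Tendsto (fun i => b i * α i + (b i * d i * ν i + 1) * α i) l atTop :=
    ((hβ.atTop_add_atTop hδα).atTop_add_atTop hα).congr fun i => by ring
  have κα : Tendsto (fun i => κ i / α i) l (nhds 0) :=
    tendsto_zero_of_sq_le (hev.mono fun i hi => racahKappa_div_alpha_sq_le
      (by linarith) hi.2.1 hi.2.2.1 hi.2.2.2) (hα.const_div_atTop 6)
  have κN : Tendsto (fun i => κ i / (b i * ν i)) l (nhds 0) :=
    tendsto_zero_of_sq_le (hev.mono fun i hi => racahKappa_div_sq_le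
      (by linarith) hi.2.1 hi.2.2.1 hi.2.2.2) (hN.const_div_atTop 6)
  have κ_of_le : ∀ Y : ι → ℝ, (∀ᶠ i in l, α i ≤ Y i) →
      Tendsto (fun i => κ i / Y i) l (nhds 0) := fun Y hY => by
    refine squeeze_zero' ?_ ?_ κα
    all_goals
      filter_upwards [hY, hev] with i hY ⟨h1, h2, h3, h4⟩
      have := racahKappa_pos (α := α i) (b := b i) (d := d i) (ν := ν i)
        (by linarith) (by linarith) (by linarith) (by linarith)
    · exact div_nonneg this.le (by linarith)
    · exact div_le_div_of_nonneg_left this.le (by linarith) hY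
  have καβ := κ_of_le (fun i => α i + b i * α i) <| by
    filter_upwards [hev] with i ⟨h1, h2, h3, h4⟩
    nlinarith
  have κβδ := κ_of_le (fun i => b i * α i + (b i * d i * ν i + 1) * α i) <| by
    filter_upwards [hev] with i ⟨h1, h2, h3, h4⟩
    have : 0 ≤ b i * d i * ν i * α i := by positivity
    nlinarith
  have hF : ∀ m : ℕ, TendsToOneRel l κ (fun i => racahAFactor (α i) (b i * α i) (b i * ν i)
      ((b i * d i * ν i + 1) * α i) m) := fun m =>
    (((((TendsToOneRel.one_add_div _ hα κα).mul (.one_add_div _ hαβ καβ)).mul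
      (.one_add_div _ hβδ κβδ)).mul (.one_add_div _ hN κN)).mul
      (TendsToOneRel.one_add_div _ hαβ καβ).inv).mul (TendsToOneRel.one_add_div _ hαβ καβ).inv
  have hG : ∀ m : ℕ, Tendsto (fun i => racahCFactor (α i) (b i * α i) (b i * ν i)
      ((b i * d i * ν i + 1) * α i) m) l (nhds 1) := fun m => by
    have key : ∀ {Y : ι → ℝ} (c : ℝ), Tendsto Y l atTop →
        TendsToOneRel l 0 (fun i => 1 + c / Y i) := fun c hY =>
      .one_add_div c hY (by simpa using tendsto_const_nhds)
    exact (((((key _ hNαβ).mul (key _ hδα)).mul (key _ hβ)).mul (key _ hαβ).inv).mul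
      (key _ hαβ).inv).1
  have hΛ : Tendsto (fun i => racahLambda (α i) (b i) (d i) (ν i)) l (nhds 0) := by
    refine tendsto_zero_of_sq_le (g := fun i => 1 / α i + 1 / (b i * ν i) + 1 / ν i)
      (hev.mono fun i hi => racahLambda_sq_le (by linarith) (by linarith) (by linarith)
        (by linarith)) ?_
    simpa using ((hα.const_div_atTop 1).add (hN.const_div_atTop 1)).add (hν.const_div_atTop 1)
  induction n using Nat.twoStepInduction with
  | zero => simpa [rescaledRacah_zero, monicHermite] using tendsto_const_nhds
  | one =>
    have h0 : √2 * (x / √2) = x := by field_simp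
    simp only [pow_one, monicHermite]
    simp only [Nat.factorial_one, Nat.cast_one, one_mul]
    norm_num
    rw [h0]
    refine tendsto_const_nhds.congr' (hev.mono fun i hi => ?_)
    beta_reduce
    rw [rescaledRacah_one (by linarith) (by linarith) (by linarith) (by linarith)]
  | more n ih₀ ih₁ =>
    have hκ := (hF (n + 1)).2.sub (hF 0).2
    have hΛG := hΛ.mul ((hG (n + 1)).const_mul ((n : ℝ) + 1))
    have hlim := ((((hκ.add hΛG).const_sub x).mul ih₁).sub
      (((hF n).1.mul ((hG (n + 1)).const_mul ((n : ℝ) + 1))).mul ih₀))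
    rw [sqrt_two_pow_mul_monicHermite_succ_succ]
    simp only [sub_zero, zero_mul, add_zero, mul_one, one_mul] at hlim
    refine hlim.congr' (hev.mono fun i hi => ?_)
    beta_reduce
    rw [rescaledRacah_succ_succ (by linarith) (by linarith) (by linarith) (by linarith)]
    ring

end Limit

/-- in the joint limit `α, b, d, ν → ∞`, the rescaled monic Racah polynomials
tend to rescaled monic Hermite polynomials. -/
theorem rescaled_racah_to_hermite :
    ∃ τ c : ℝ, τ ≠ 0 ∧ ∀ (n : ℕ) (x : ℝ),
      Filter.Tendsto
        (fun p : ℝ × ℝ × ℝ × ℝ =>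
          rescaledRacah (1 / p.1) (1 / p.2.1) (1 / p.2.2.1) (1 / p.2.2.2) n x)
        (nhdsWithin 0 (Set.Ioi 0 ×ˢ (Set.Ioi 0 ×ˢ (Set.Ioi 0 ×ˢ Set.Ioi 0))))
        (nhds (τ ^ n * monicHermite n ((x - c) / τ))) := by
  have key : ∀ f : ℝ × ℝ × ℝ × ℝ → ℝ, Continuous f → f 0 = 0 →
      (∀ p ∈ (Set.Ioi 0 ×ˢ (Set.Ioi 0 ×ˢ (Set.Ioi 0 ×ˢ Set.Ioi 0)) : Set (ℝ × ℝ × ℝ × ℝ)),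
        0 < f p) →
      Tendsto (fun p => 1 / f p)
        (nhdsWithin 0 (Set.Ioi 0 ×ˢ (Set.Ioi 0 ×ˢ (Set.Ioi 0 ×ˢ Set.Ioi 0)))) atTop := by
    intro f hf h0 hpos
    simp only [one_div]
    refine tendsto_inv_nhdsGT_zero.comp (tendsto_nhdsWithin_iff.2 ⟨?_, ?_⟩)
    · exact (h0 ▸ hf.tendsto 0 : Tendsto f (nhds 0) (nhds 0)).mono_left nhdsWithin_le_nhds
    · exact eventually_nhdsWithin_of_forall hpos
  refine ⟨√2, 0, by positivity, fun n x => ?_⟩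
  rw [sub_zero]
  exact tendsto_rescaledRacah (key _ (by fun_prop) rfl fun p hp => hp.1)
    (key _ (by fun_prop) rfl fun p hp => hp.2.1) (key _ (by fun_prop) rfl fun p hp => hp.2.2.1)
    (key _ (by fun_prop) rfl fun p hp => hp.2.2.2) x n
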